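/- Let {u₁, …, u_k} be a minimal generating set of the monoid S and let v = Σ_{i ∈ I} uᵢ for some subset I ⊆ {1, …, k}. Then the GIT-cone λ(v) ⊆ ℚ^n equals the convex cone generated by the set {uᵢ : X^{ss}(v) ⊆ X^{ss}(uᵢ)}. -/

import Mathlib

open scoped BigOperators

/-- The character `χ^s` in the monoid algebra `ℂ[S]`. -/
noncomputable def chi {n : ℕ} (S : AddSubmonoid (Fin n → ℤ)) (s : S) :
    AddMonoidAlgebra ℂ S :=
  AddMonoidAlgebra.single s 1

/-- The homogeneous component of degree `m ∈ M = ℤ^n` of the `M`-graded algebra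
`A = ℂ[S]`: it is `ℂ · χ^m` if `m ∈ S` and `0` otherwise. -/
noncomputable def homComponent {n : ℕ} (S : AddSubmonoid (Fin n → ℤ)) (m : Fin n → ℤ) :
    Submodule ℂ (AddMonoidAlgebra ℂ S) :=
  Submodule.span ℂ {f | ∃ s : S, (s : Fin n → ℤ) = m ∧ f = chi S s}

/-- The semistable locus `X^{ss}(u) ⊆ Spec A`: the union of the basic open sets `D(f)`
over all integers `k > 0` and all `f` in the component of degree `k • u`. -/
noncomputable def ssLocus {n : ℕ} (S : AddSubmonoid (Fin n → ℤ)) (u : Fin n → ℤ) :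
    Set (PrimeSpectrum (AddMonoidAlgebra ℂ S)) :=
  ⋃ (k : ℕ) (_ : 0 < k) (f ∈ homComponent S (k • u)), {p | f ∉ p.asIdeal}


/-- The canonical embedding `ℤ^n → ℚ^n`. -/
def toQ {n : ℕ} (u : Fin n → ℤ) : Fin n → ℚ := fun i => (u i : ℚ)

/-- The convex cone in `ℚ^n` generated by a set `G`. -/
def coneGen {n : ℕ} (G : Set (Fin n → ℚ)) : Set (Fin n → ℚ) :=
  {x | ∃ (k : ℕ) (c : Fin k → ℚ) (g : Fin k → (Fin n → ℚ)),
    (∀ j, 0 ≤ c j) ∧ (∀ j, g j ∈ G) ∧ x = ∑ j, c j • g j}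

/-- The orbit monoid of a (closed) point `x : A → ℂ`: all degrees `u ∈ M` admitting a
homogeneous `f ∈ A_u` with `x(f) ≠ 0`. -/
noncomputable def orbitMonoid {n : ℕ} (S : AddSubmonoid (Fin n → ℤ))
    (x : AddMonoidAlgebra ℂ S →ₐ[ℂ] ℂ) : Set (Fin n → ℤ) :=
  {u | ∃ f ∈ homComponent S u, x f ≠ 0}

/-- The orbit cone of a point `x`: the convex cone generated by the orbit monoid. -/
noncomputable def orbitCone {n : ℕ} (S : AddSubmonoid (Fin n → ℤ))
    (x : AddMonoidAlgebra ℂ S →ₐ[ℂ] ℂ) : Set (Fin n → ℚ) :=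
  coneGen (toQ '' orbitMonoid S x)

/-- The GIT-cone `λ(v)`: the intersection of all orbit cones containing `v`. -/
noncomputable def gitCone {n : ℕ} (S : AddSubmonoid (Fin n → ℤ)) (v : Fin n → ℚ) :
    Set (Fin n → ℚ) :=
  ⋂ (x : AddMonoidAlgebra ℂ S →ₐ[ℂ] ℂ) (_ : v ∈ orbitCone S x), orbitCone S x

theorem coneGen_eq_span {n : ℕ} (G : Set (Fin n → ℚ)) :
    coneGen G = (Submodule.span ℚ≥0 G : Set (Fin n → ℚ)) := by
  ext x
  simp only [SetLike.mem_coe, Submodule.mem_span_set', coneGen, Set.mem_setOf_eq]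
  constructor
  · rintro ⟨k, c, g, hc, hg, rfl⟩
    exact ⟨k, fun j => ⟨c j, hc j⟩, fun j => ⟨g j, hg j⟩, rfl⟩
  · rintro ⟨k, c, g, rfl⟩
    exact ⟨k, fun j => (c j : ℚ), fun j => (g j : Fin n → ℚ), fun j => (c j).2,
      fun j => (g j).2, rfl⟩

theorem toQ_add {n : ℕ} (a b : Fin n → ℤ) : toQ (a + b) = toQ a + toQ b := by
  ext i; simp [toQ]

theorem toQ_zero {n : ℕ} : toQ (0 : Fin n → ℤ) = 0 := by
  ext i; simp [toQ]

theorem toQ_nsmul {n : ℕ} (m : ℕ) (a : Fin n → ℤ) : toQ (m • a) = m • toQ a := by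
  ext i; simp [toQ]

theorem toQ_inj {n : ℕ} {a b : Fin n → ℤ} (h : toQ a = toQ b) : a = b := by
  ext i
  have := congrFun h i
  simpa [toQ] using this

theorem chi_add {n : ℕ} (S : AddSubmonoid (Fin n → ℤ)) (s t : S) :
    chi S (s + t) = chi S s * chi S t := by
  simp [chi, AddMonoidAlgebra.single_mul_single]

theorem chi_zero {n : ℕ} (S : AddSubmonoid (Fin n → ℤ)) : chi S 0 = 1 := rfl

theorem chi_nsmul {n : ℕ} (S : AddSubmonoid (Fin n → ℤ)) (m : ℕ) (s : S) :
    chi S (m • s) = chi S s ^ m := by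
  induction m with
  | zero => simp [chi_zero]
  | succ m ih => rw [succ_nsmul, chi_add, ih, pow_succ]

theorem homComponent_le {n : ℕ} (S : AddSubmonoid (Fin n → ℤ)) (s : S)
    (N : Submodule ℂ (AddMonoidAlgebra ℂ S)) (h : chi S s ∈ N) :
    homComponent S (s : Fin n → ℤ) ≤ N := by
  refine Submodule.span_le.2 ?_
  rintro f ⟨t, ht, rfl⟩
  rwa [Subtype.ext ht]

theorem chi_mem {n : ℕ} (S : AddSubmonoid (Fin n → ℤ)) (s : S) :
    chi S s ∈ homComponent S (s : Fin n → ℤ) :=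
  Submodule.subset_span ⟨s, rfl, rfl⟩

theorem mem_ssLocus {n : ℕ} (S : AddSubmonoid (Fin n → ℤ)) (s : S)
    (p : PrimeSpectrum (AddMonoidAlgebra ℂ S)) :
    p ∈ ssLocus S (s : Fin n → ℤ) ↔ chi S s ∉ p.asIdeal := by
  simp only [ssLocus, Set.mem_iUnion, Set.mem_setOf_eq, exists_prop]
  constructor
  · rintro ⟨m, hm, f, hf, hfp⟩ h
    refine hfp (homComponent_le S (m • s) (p.asIdeal.restrictScalars ℂ) ?_ hf)
    show chi S (m • s) ∈ p.asIdeal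
    rw [chi_nsmul]
    exact Ideal.pow_mem_of_mem _ h m hm
  · intro h
    refine ⟨1, one_pos, chi S s, ?_, h⟩
    rw [one_smul]
    exact chi_mem S s

theorem mem_orbitMonoid {n : ℕ} (S : AddSubmonoid (Fin n → ℤ))
    (x : AddMonoidAlgebra ℂ S →ₐ[ℂ] ℂ) (u : Fin n → ℤ) :
    u ∈ orbitMonoid S x ↔ ∃ s : S, (s : Fin n → ℤ) = u ∧ x (chi S s) ≠ 0 := by
  constructor
  · rintro ⟨f, hf, hx⟩
    by_contra! h
    refine hx ?_
    have : homComponent S u ≤ LinearMap.ker x.toLinearMap := by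
      refine Submodule.span_le.2 ?_
      rintro f ⟨t, ht, rfl⟩
      exact h t ht
    exact this hf
  · rintro ⟨s, rfl, h⟩
    exact ⟨_, chi_mem S s, h⟩

/-- Membership in the smallest face of `S` containing `v`. -/
def InFace {n : ℕ} (S : AddSubmonoid (Fin n → ℤ)) (v s : S) : Prop :=
  ∃ (m : ℕ) (t : S), m • v = s + t

theorem inFace_add {n : ℕ} (S : AddSubmonoid (Fin n → ℤ)) (v s t : S) :
    InFace S v (s + t) ↔ InFace S v s ∧ InFace S v t := by
  constructor
  · rintro ⟨m, r, h⟩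
    exact ⟨⟨m, t + r, by rw [h, add_assoc]⟩, ⟨m, s + r, by rw [h]; abel⟩⟩
  · rintro ⟨⟨m, r, h⟩, ⟨m', r', h'⟩⟩
    exact ⟨m + m', r + r', by rw [add_smul, h, h']; abel⟩

theorem inFace_zero {n : ℕ} (S : AddSubmonoid (Fin n → ℤ)) (v : S) : InFace S v 0 :=
  ⟨0, 0, by simp⟩

theorem inFace_self {n : ℕ} (S : AddSubmonoid (Fin n → ℤ)) (v : S) : InFace S v v :=
  ⟨1, 0, by simp⟩

open Classical in
/-- The distinguished point of the face. -/
noncomputable def facePoint {n : ℕ} (S : AddSubmonoid (Fin n → ℤ)) (v : S) :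
    AddMonoidAlgebra ℂ S →ₐ[ℂ] ℂ :=
  AddMonoidAlgebra.lift ℂ ℂ S
    { toFun := fun s => if InFace S v s.toAdd then 1 else 0
      map_one' := by simp [inFace_zero]
      map_mul' := fun s t => by
        rw [toAdd_mul, inFace_add]
        by_cases h : InFace S v s.toAdd <;> by_cases h' : InFace S v t.toAdd <;> simp [h, h'] }

theorem facePoint_chi {n : ℕ} (S : AddSubmonoid (Fin n → ℤ)) (v s : S) :
    facePoint S v (chi S s) ≠ 0 ↔ InFace S v s := by
  simp [facePoint, chi, AddMonoidAlgebra.lift_single]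

theorem ss_subset_iff {n : ℕ} (S : AddSubmonoid (Fin n → ℤ)) (v u : S) :
    ssLocus S (v : Fin n → ℤ) ⊆ ssLocus S (u : Fin n → ℤ) ↔ InFace S v u := by
  constructor
  · intro h
    let p : PrimeSpectrum (AddMonoidAlgebra ℂ S) :=
      ⟨RingHom.ker (facePoint S v), RingHom.ker_isPrime _⟩
    have hp : p ∈ ssLocus S (v : Fin n → ℤ) :=
      (mem_ssLocus S v p).2 ((facePoint_chi S v v).2 (inFace_self S v))
    exact (facePoint_chi S v u).1 ((mem_ssLocus S u p).1 (h hp))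
  · rintro ⟨m, t, h⟩ p hp
    rw [mem_ssLocus] at hp ⊢
    intro hu
    refine hp (p.2.mem_of_pow_mem m ?_)
    rw [← chi_nsmul, h, chi_add]
    exact Ideal.mul_mem_right _ _ hu

theorem clear_denoms {n : ℕ} (T : AddSubmonoid (Fin n → ℤ)) (y : Fin n → ℚ)
    (hy : y ∈ Submodule.span ℚ≥0 (toQ '' (T : Set (Fin n → ℤ)))) :
    ∃ N : ℕ, 0 < N ∧ ∃ t ∈ T, N • y = toQ t := by
  induction hy using Submodule.span_induction with
  | mem y hy =>
    obtain ⟨t, ht, rfl⟩ := hy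
    exact ⟨1, one_pos, t, ht, one_smul _ _⟩
  | zero => exact ⟨1, one_pos, 0, T.zero_mem, by simp [toQ_zero]⟩
  | add a b _ _ ha hb =>
    obtain ⟨N, hN, t, ht, h⟩ := ha
    obtain ⟨N', hN', t', ht', h'⟩ := hb
    refine ⟨N * N', Nat.mul_pos hN hN', N' • t + N • t',
      T.add_mem (T.nsmul_mem ht _) (T.nsmul_mem ht' _), ?_⟩
    rw [toQ_add, toQ_nsmul, toQ_nsmul, ← h, ← h', smul_add, smul_smul, smul_smul, mul_comm N']
  | smul c a _ ha =>
    obtain ⟨N, hN, t, ht, h⟩ := ha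
    refine ⟨N * c.den, Nat.mul_pos hN c.den_pos, c.num • t, T.nsmul_mem ht _, ?_⟩
    rw [toQ_nsmul, ← h]
    have hc : (c.den : ℚ≥0) * c = c.num := NNRat.den_mul_eq_num c
    rw [← Nat.cast_smul_eq_nsmul ℚ≥0, ← Nat.cast_smul_eq_nsmul ℚ≥0 c.num,
      ← Nat.cast_smul_eq_nsmul ℚ≥0 N, smul_smul, smul_smul, Nat.cast_mul, mul_assoc, hc, mul_comm]

/-- The orbit monoid as a submonoid. -/
noncomputable def orbitSub {n : ℕ} (S : AddSubmonoid (Fin n → ℤ))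
    (x : AddMonoidAlgebra ℂ S →ₐ[ℂ] ℂ) : AddSubmonoid (Fin n → ℤ) where
  carrier := orbitMonoid S x
  zero_mem' := (mem_orbitMonoid S x 0).2 ⟨0, rfl, by simp [chi_zero]⟩
  add_mem' := by
    intro a b ha hb
    rw [mem_orbitMonoid] at ha hb ⊢
    obtain ⟨s, rfl, hs⟩ := ha
    obtain ⟨t, rfl, ht⟩ := hb
    exact ⟨s + t, rfl, by rw [chi_add, map_mul]; exact mul_ne_zero hs ht⟩

/-- If `{u₁, …, u_k}` is a minimal generating set of `S` and `v = Σ_{i ∈ I} uᵢ`, then the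
GIT-cone `λ(v)` is the convex cone generated by `{uᵢ : X^{ss}(v) ⊆ X^{ss}(uᵢ)}`. -/
theorem gitCone_eq_coneGen {n : ℕ} (C : Set (Fin n → ℚ))
    (hpoly : ∃ (k : ℕ) (g : Fin k → (Fin n → ℚ)),
      C = {x | ∃ c : Fin k → ℚ, (∀ i, 0 ≤ c i) ∧ x = ∑ i, c i • g i})
    (hfull : Submodule.span ℚ C = ⊤)
    (S : AddSubmonoid (Fin n → ℤ))
    (hS : (S : Set (Fin n → ℤ)) = {u : Fin n → ℤ | (fun i => (u i : ℚ)) ∈ C})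
    (k : ℕ) (U : Fin k → S)
    (hgen : AddSubmonoid.closure (Set.range fun i => (U i : Fin n → ℤ)) = S)
    (hmin : ∀ j : Fin k,
      AddSubmonoid.closure ((fun i => (U i : Fin n → ℤ)) '' {i | i ≠ j}) ≠ S)
    (I : Finset (Fin k)) (v : Fin n → ℤ) (hv : v = ∑ i ∈ I, (U i : Fin n → ℤ)) :
    gitCone S (toQ v) =
      coneGen {w : Fin n → ℚ |
        ∃ i : Fin k, ssLocus S v ⊆ ssLocus S (U i : Fin n → ℤ) ∧ w = toQ (U i : Fin n → ℤ)} := by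
  have hvS : v ∈ S := by
    rw [hv]
    exact S.sum_mem fun i _ => (U i).2
  obtain ⟨w, rfl⟩ : ∃ w : S, (w : Fin n → ℤ) = v := ⟨⟨v, hvS⟩, rfl⟩
  simp only [ss_subset_iff]
  clear hv hvS
  apply Set.Subset.antisymm
  · intro y hy
    have hy' : y ∈ orbitCone S (facePoint S w) := by
      refine Set.mem_iInter₂.1 hy (facePoint S w) ?_
      rw [orbitCone, coneGen_eq_span]
      exact Submodule.subset_span ⟨w, (mem_orbitMonoid _ _ _).2
        ⟨w, rfl, (facePoint_chi S w w).2 (inFace_self S w)⟩, rfl⟩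
    rw [orbitCone, coneGen_eq_span] at hy'
    rw [coneGen_eq_span]
    refine Submodule.span_le.2 ?_ hy'
    rintro _ ⟨u, hu, rfl⟩
    obtain ⟨s, rfl, hs⟩ := (mem_orbitMonoid _ _ _).1 hu
    rw [facePoint_chi] at hs
    have key : ∀ a ∈ AddSubmonoid.closure (Set.range fun i => (U i : Fin n → ℤ)),
        ∀ s : S, (s : Fin n → ℤ) = a → InFace S w s → toQ a ∈ Submodule.span ℚ≥0
          {z : Fin n → ℚ | ∃ i : Fin k, InFace S w (U i) ∧ z = toQ (U i : Fin n → ℤ)} := by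
      intro a ha
      induction ha using AddSubmonoid.closure_induction with
      | mem a ha =>
        obtain ⟨i, rfl⟩ := ha
        intro s hs hf
        rw [Subtype.ext hs] at hf
        exact Submodule.subset_span ⟨i, hf, rfl⟩
      | zero =>
        intro _ _ _
        rw [toQ_zero]
        exact Submodule.zero_mem _
      | add a b ha hb iha ihb =>
        intro s hs hf
        rw [hgen] at ha hb
        have : s = ⟨a, ha⟩ + ⟨b, hb⟩ := Subtype.ext hs
        rw [this, inFace_add] at hf
        rw [toQ_add]
        exact Submodule.add_mem _ (iha _ rfl hf.1) (ihb _ rfl hf.2)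
    exact key s (by rw [hgen]; exact s.2) s rfl hs
  · intro y hy
    refine Set.mem_iInter₂.2 fun x hx => ?_
    rw [coneGen_eq_span] at hy
    rw [orbitCone, coneGen_eq_span] at hx ⊢
    obtain ⟨N, hN, t, ht, h⟩ := clear_denoms (orbitSub S x) _ hx
    rw [← toQ_nsmul] at h
    have h := toQ_inj h
    obtain ⟨s, hst, hs⟩ := (mem_orbitMonoid _ _ _).1 ht
    have hsN : N • w = s := Subtype.ext (by rw [hst, ← h]; rfl)
    rw [← hsN, chi_nsmul, map_pow] at hs
    have hw : x (chi S w) ≠ 0 := fun h0 => hs (by rw [h0, zero_pow hN.ne'])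
    refine Submodule.span_mono ?_ hy
    rintro _ ⟨i, ⟨m, r, hm⟩, rfl⟩
    refine ⟨_, (mem_orbitMonoid _ _ _).2 ⟨U i, rfl, fun h0 => pow_ne_zero m hw ?_⟩, rfl⟩
    rw [← map_pow, ← chi_nsmul, hm, chi_add, map_mul, h0, zero_mul]
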